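/- Let S_λ be a contractive weighted shift with strictly positive weights on a directed tree 𝒯 = (V, E), and suppose S_λ is of class C_{1·}. If either (i) 𝒯 has a root, or (ii) 𝒯 has no root and Br(𝒯) < ∞, then the adjoint S_λ* is cyclic. -/

import Mathlib

open Filter Topology

/-- `E` is the edge relation of a directed tree on the vertex set `V`:
no loops, every vertex has at most one parent, the underlying undirected graph is
connected (any two distinct vertices are joined by a finite undirected path), and
there is no directed circuit. -/
def IsDirectedTree {V : Type*} (E : V → V → Prop) : Prop :=
  (∀ v, ¬ E v v) ∧
  (∀ u u' v, E u v → E u' v → u = u') ∧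
  (∀ u v : V, Relation.ReflTransGen (fun a b => E a b ∨ E b a) u v) ∧
  (∀ (n : ℕ) (f : Fin (n + 2) → V), Function.Injective f →
    ¬ ((∀ i : Fin (n + 1), E (f i.castSucc) (f i.succ)) ∧ E (f (Fin.last (n + 1))) (f 0)))

/-- The set `Chi(W)` of children of the vertices in `W`; its `n`-th iterate applied to `{u}`
is `Chiⁿ(u)`. -/
def chi {V : Type*} (E : V → V → Prop) (W : Set V) : Set V :=
  {v | ∃ u ∈ W, E u v}

/-- The parent `Par(v)` of a vertex `v` (by convention `v` itself if `v` has no parent). -/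
noncomputable def par {V : Type*} (E : V → V → Prop) (v : V) : V :=
  haveI := Classical.propDecidable (∃ u, E u v)
  if h : ∃ u, E u v then h.choose else v

/-- `Parⁿ(u)` exists, i.e. the whole ancestor chain of length `n` above `u` exists. -/
def parIterExists {V : Type*} (E : V → V → Prop) (n : ℕ) (u : V) : Prop :=
  ∀ j < n, ∃ w, E w ((par E)^[j] u)

/-- The level (whole generation) `Gen(u) = ⋃_j Chi^j(Par^j(u))` of a vertex `u`. -/
def gen {V : Type*} (E : V → V → Prop) (u : V) : Set V :=
  ⋃ j : ℕ, (chi E)^[j] {(par E)^[j] u}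

/-- The standard orthonormal basis vector `e_u` of `ℓ²(V)`. -/
noncomputable def evec {V : Type*} (u : V) : lp (fun _ : V => ℂ) 2 :=
  haveI := Classical.decEq V
  lp.single 2 u 1

/-- `f` is a cyclic vector for the bounded linear operator `T`: the closed linear span of the
orbit `{Tⁿ f : n ∈ ℤ₊}` is the whole space. -/
def IsCyclicVector {H : Type*} [NormedAddCommGroup H] [NormedSpace ℂ H]
    (T : H →L[ℂ] H) (f : H) : Prop :=
  (Submodule.span ℂ (Set.range fun n : ℕ => (T ^ n) f)).topologicalClosure = ⊤

open Polynomial in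
theorem exists_forall_mem_closure_orbit {H ι : Type*} [NormedAddCommGroup H] [NormedSpace ℂ H]
    [CompleteSpace H] [Countable ι] (T : H →L[ℂ] H) (b : H) (K : Submodule ℂ H)
    (hnil : ∀ s ∈ K, ∃ n : ℕ, (T ^ n) s = 0) (hsurj : ∀ s ∈ K, ∃ w ∈ K, T w = s)
    (hb : b ∈ closure (Set.range fun p : ℂ[X] => aeval T (X * p) b)) (y : ι → H)
    (hy : ∀ i, ∃ s ∈ K, y i - s ∈ closure (Set.range fun p : ℂ[X] => aeval T p b)) :
    ∃ f, ∀ i, y i ∈ closure (Set.range fun p : ℂ[X] => aeval T p f) := by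
  have hsurj' : ∀ n : ℕ, ∀ s ∈ K, ∃ w ∈ K, (T ^ n) w = s := by
    intro n
    induction n with
    | zero => intro s hs; exact ⟨s, hs, rfl⟩
    | succ n ih =>
      intro s hs
      obtain ⟨w, hw, rfl⟩ := hsurj s hs
      obtain ⟨w', hw', rfl⟩ := ih w hw
      exact ⟨w', hw', by rw [pow_succ']; rfl⟩
  have hshift : ∀ N : ℕ, closure (Set.range fun p : ℂ[X] => aeval T p b) ⊆
      closure (Set.range fun p : ℂ[X] => aeval T (X ^ N * p) b) := by
    intro N
    induction N with
    | zero => simp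
    | succ N ih =>
      refine ih.trans (closure_minimal ?_ isClosed_closure)
      rintro _ ⟨p, rfl⟩
      refine map_mem_closure (aeval T (X ^ N * p)).continuous hb ?_
      rintro _ ⟨q, rfl⟩
      refine ⟨p * q, ?_⟩
      have h : aeval T (X ^ (N + 1) * (p * q)) = aeval T (X ^ N * p) * aeval T (X * q) := by
        rw [← map_mul]
        congr 1
        ring
      exact DFunLike.congr_fun h b
  have happ : ∀ m ∈ closure (Set.range fun p : ℂ[X] => aeval T p b), ∀ N : ℕ, ∀ ε > 0,
      ∃ p : ℂ[X], ‖(T ^ N) (aeval T p b) - m‖ < ε := by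
    intro m hm N ε hε
    obtain ⟨_, ⟨p, rfl⟩, hp⟩ := Metric.mem_closure_iff.1 (hshift N hm) ε hε
    refine ⟨p, ?_⟩
    rw [dist_comm, dist_eq_norm] at hp
    simpa using hp
  let W := K.topologicalClosure
  have : CompleteSpace W := K.isClosed_topologicalClosure.completeSpace_coe
  let O : ι × ℕ → Set W := fun i =>
    ⋃ p : ℂ[X], {s : W | ‖aeval T p (b + s) - y i.1‖ < 1 / ((i.2 : ℝ) + 1)}
  have hO : ∀ i, IsOpen (O i) := fun i => isOpen_iUnion fun p =>
    isOpen_lt (by fun_prop) continuous_const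
  have hd : ∀ i, Dense (O i) := by
    rintro ⟨i, k⟩
    rw [Metric.dense_iff]
    rintro ⟨s₀, hs₀⟩ δ hδ
    have hε : (0 : ℝ) < 1 / ((k : ℝ) + 1) := by positivity
    set ε : ℝ := 1 / ((k : ℝ) + 1)
    obtain ⟨s₁, hs₁, hs₁'⟩ := Metric.mem_closure_iff.1 hs₀ (δ / 2) (half_pos hδ)
    obtain ⟨n, hn⟩ := hnil s₁ hs₁
    obtain ⟨t, ht, hm⟩ := hy i
    obtain ⟨N, hN⟩ := hnil t ht
    obtain ⟨w, hw, hwt⟩ := hsurj' n t ht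
    obtain ⟨C, hC⟩ := exists_gt (‖w‖ / (δ / 2))
    have hC0 : 0 < C := lt_of_le_of_lt (by positivity) hC
    obtain ⟨q, hq⟩ := happ _ hm (n + N) (ε / 2) (half_pos hε)
    have hbm : -b ∈ closure (Set.range fun p : ℂ[X] => aeval T p b) :=
      subset_closure ⟨-1, by simp⟩
    obtain ⟨r, hr⟩ := happ _ hbm N (ε / 2 / (C * (‖T ^ n‖ + 1))) (by positivity)
    have hs : s₁ + (C⁻¹ : ℂ) • w ∈ W :=
      K.le_topologicalClosure (K.add_mem hs₁ (K.smul_mem _ hw))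
    refine ⟨⟨_, hs⟩, ?_, Set.mem_iUnion.2
      ⟨X ^ n * (X ^ N * q + (Polynomial.C (C : ℂ)) * (1 + X ^ N * r)), ?_⟩⟩
    · rw [Metric.mem_ball, Subtype.dist_eq]
      have h1 : ‖(C⁻¹ : ℂ) • w‖ < δ / 2 := by
        rw [norm_smul, norm_inv, Complex.norm_real, Real.norm_of_nonneg hC0.le,
          inv_mul_lt_iff₀ hC0]
        rwa [div_lt_iff₀ (half_pos hδ)] at hC
      calc dist (s₁ + (C⁻¹ : ℂ) • w) s₀ ≤ dist (s₁ + (C⁻¹ : ℂ) • w) s₁ + dist s₁ s₀ :=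
            dist_triangle _ _ _
        _ < δ / 2 + δ / 2 := by
            rw [dist_comm s₁ s₀, dist_self_add_left]
            exact add_lt_add h1 hs₁'
        _ = δ := add_halves δ
    · have hcomm : ∀ (m : ℕ) (p : ℂ[X]) (x : H),
          (T ^ m) (aeval T p x) = aeval T p ((T ^ m) x) := by
        intro m p x
        have h : T ^ m * aeval T p = aeval T p * T ^ m := by
          simpa using congrArg (aeval T) (mul_comm (X ^ m) p)
        exact DFunLike.congr_fun h x
      have hswap : ∀ x : H, (T ^ n) ((T ^ N) x) = (T ^ N) ((T ^ n) x) := fun x =>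
        DFunLike.congr_fun (pow_mul_comm T n N) x
      have hkey : aeval T (X ^ n * (X ^ N * q + (Polynomial.C (C : ℂ)) * (1 + X ^ N * r)))
          (b + (s₁ + (C⁻¹ : ℂ) • w)) - y i = ((T ^ (n + N)) (aeval T q b) - (y i - t)) +
            (C : ℂ) • (T ^ n) ((T ^ N) (aeval T r b) - -b) := by
        have hCC : (C : ℂ) ≠ 0 := by exact_mod_cast hC0.ne'
        simp only [map_mul, map_add, map_pow, aeval_X, aeval_C, map_one, pow_add,
          mul_apply_eq_comp, add_apply, map_smul,
          Algebra.algebraMap_eq_smul_one, smul_apply,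
          one_apply_eq_self, hcomm, hswap, hn, hwt, hN, map_zero, map_sub, map_neg,
          smul_add, smul_zero, smul_smul, inv_mul_cancel₀ hCC, one_smul]
        simp only [sub_neg_eq_add, smul_add]
        abel
      show ‖_‖ < ε
      simp only
      rw [hkey]
      have h2 : ‖(C : ℂ) • (T ^ n) ((T ^ N) (aeval T r b) - -b)‖ ≤ ε / 2 := by
        rw [norm_smul, Complex.norm_real, Real.norm_of_nonneg hC0.le]
        have h3 := (T ^ n).le_opNorm ((T ^ N) (aeval T r b) - -b)
        have h4 : 0 < C * (‖T ^ n‖ + 1) := by positivity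
        rw [lt_div_iff₀ h4] at hr
        have h5 := norm_nonneg ((T ^ N) (aeval T r b) - -b)
        nlinarith
      calc _ ≤ _ := norm_add_le _ _
        _ < ε / 2 + ε / 2 := add_lt_add_of_lt_of_le hq h2
        _ = ε := add_halves ε
  obtain ⟨s, hs⟩ := (dense_iInter_of_isOpen hO hd).nonempty
  refine ⟨b + s, fun i => Metric.mem_closure_iff.2 fun ε hε => ?_⟩
  obtain ⟨k, hk⟩ := exists_nat_one_div_lt hε
  obtain ⟨p, hp⟩ := Set.mem_iUnion.1 (Set.mem_iInter.1 hs (i, k))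
  exact ⟨_, ⟨p, rfl⟩, by rw [dist_comm, dist_eq_norm]; exact hp.trans hk⟩

open Polynomial in
/-- The closure in `C(ℝ/ℤ)` of the polynomials without constant term in `z = fourier 1`. -/
noncomputable def diskIdeal : Submodule ℂ C(UnitAddCircle, ℂ) :=
  (LinearMap.range
    ((aeval (fourier 1 : C(UnitAddCircle, ℂ))).toLinearMap ∘ₗ
      LinearMap.mulLeft ℂ (X : ℂ[X]))).topologicalClosure

open Polynomial in
theorem coe_diskIdeal : (diskIdeal : Set C(UnitAddCircle, ℂ)) =
    closure (Set.range fun p : ℂ[X] => aeval (fourier 1 : C(UnitAddCircle, ℂ)) (X * p)) := by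
  rw [diskIdeal, Submodule.topologicalClosure_coe, LinearMap.coe_range]
  rfl

theorem isClosed_diskIdeal : IsClosed (diskIdeal : Set C(UnitAddCircle, ℂ)) :=
  Submodule.isClosed_topologicalClosure _

theorem fourier_one_mem_diskIdeal : (fourier 1 : C(UnitAddCircle, ℂ)) ∈ diskIdeal := by
  rw [← SetLike.mem_coe, coe_diskIdeal]
  exact subset_closure ⟨1, by simp⟩

theorem mul_mem_diskIdeal {f h : C(UnitAddCircle, ℂ)} (hf : f ∈ diskIdeal) (hh : h ∈ diskIdeal) :
    f * h ∈ diskIdeal := by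
  rw [← SetLike.mem_coe, coe_diskIdeal] at *
  refine map_mem_closure₂ continuous_mul hf hh ?_
  rintro _ ⟨p, rfl⟩ _ ⟨q, rfl⟩
  refine ⟨p * (Polynomial.X * q), ?_⟩
  simp only [← map_mul]
  congr 1
  ring

theorem pow_succ_mem_diskIdeal {f : C(UnitAddCircle, ℂ)} (hf : f ∈ diskIdeal) (n : ℕ) :
    f ^ (n + 1) ∈ diskIdeal := by
  induction n with
  | zero => simpa using hf
  | succ n ih => exact mul_mem_diskIdeal ih hf

theorem exp_sub_one_mem_diskIdeal {f : C(UnitAddCircle, ℂ)} (hf : f ∈ diskIdeal) :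
    NormedSpace.exp f - 1 ∈ diskIdeal := by
  have h := NormedSpace.exp_series_hasSum_exp' (𝕂 := ℂ) f
  rw [← hasSum_nat_add_iff' 1] at h
  simp only [Finset.sum_range_one, Nat.factorial_zero, Nat.cast_one, inv_one, pow_zero,
    one_smul] at h
  exact isClosed_diskIdeal.mem_of_tendsto h (Eventually.of_forall fun s =>
    Submodule.sum_mem _ fun n _ => Submodule.smul_mem _ _ (pow_succ_mem_diskIdeal hf n))

theorem norm_fourier_one_apply (x : UnitAddCircle) : ‖fourier 1 x‖ = 1 :=
  Circle.norm_coe _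

theorem exists_herglotz_mem_diskIdeal {r : ℝ} (hr0 : 0 ≤ r) (hr1 : r < 1) :
    ∃ Q ∈ diskIdeal, ∀ x, Q x * (1 - r * fourier 1 x) = 2 * (r * fourier 1 x) := by
  set a : C(UnitAddCircle, ℂ) := (r : ℂ) • fourier 1 with ha
  have ha1 : ‖a‖ < 1 := by
    rw [ha, norm_smul, Complex.norm_real, Real.norm_of_nonneg hr0]
    have : ‖(fourier 1 : C(UnitAddCircle, ℂ))‖ ≤ 1 :=
      (ContinuousMap.norm_le _ zero_le_one).2 fun x => (norm_fourier_one_apply x).le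
    nlinarith
  have haD : a ∈ diskIdeal := Submodule.smul_mem _ _ fourier_one_mem_diskIdeal
  have hsum := (summable_geometric_of_norm_lt_one ha1).hasSum
  refine ⟨(2 : ℂ) • (a * ∑' n, a ^ n), Submodule.smul_mem _ _ ?_, fun x => ?_⟩
  · refine isClosed_diskIdeal.mem_of_tendsto (hsum.mul_left a)
      (Eventually.of_forall fun s => Submodule.sum_mem _ fun n _ => ?_)
    rw [← pow_succ']
    exact pow_succ_mem_diskIdeal haD n
  · have h := DFunLike.congr_fun (geom_series_mul_neg a ha1) x
    have hax : a x = r * fourier 1 x := rfl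
    simp only [ContinuousMap.mul_apply, ContinuousMap.sub_apply, ContinuousMap.one_apply,
      ContinuousMap.smul_apply, smul_eq_mul] at h ⊢
    rw [← hax]
    linear_combination 2 * a x * h

theorem re_herglotz {r : ℝ} {z q : ℂ} (hr0 : 0 ≤ r) (hr1 : r < 1) (hz : ‖z‖ = 1)
    (hq : q * (1 - r * z) = 2 * (r * z)) :
    q.re = (1 - r ^ 2) / ((1 - r) ^ 2 + r * ‖1 - z‖ ^ 2) - 1 := by
  have hz2 : z.re ^ 2 + z.im ^ 2 = 1 := by
    have := Complex.sq_norm z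
    rw [hz, Complex.normSq_apply] at this
    linarith
  have hd : ‖1 - z‖ ^ 2 = 2 - 2 * z.re := by
    rw [Complex.sq_norm, Complex.normSq_apply]
    simp only [Complex.sub_re, Complex.sub_im, Complex.one_re, Complex.one_im]
    linarith
  have hden : 0 < (1 - r) ^ 2 + r * ‖1 - z‖ ^ 2 := by
    have := sub_pos.2 hr1
    positivity
  rw [hd] at hden ⊢
  rw [eq_sub_iff_add_eq, eq_div_iff hden.ne']
  have h1 := congrArg Complex.re hq
  have h2 := congrArg Complex.im hq
  simp at h1 h2
  linear_combination (1 - r * z.re) * h1 - r * z.im * h2 - (q.re + 2) * r ^ 2 * hz2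

/-- A nonnegative continuous function on the circle which vanishes only at `0`, where it is so flat
that it is a cyclic vector for multiplication by `fourier 1`. -/
noncomputable def flat : C(UnitAddCircle, ℂ) where
  toFun x := (expNegInvGlue (‖1 - fourier 1 x‖ ^ 4) : ℂ)
  continuous_toFun := by
    have := (expNegInvGlue.contDiff (n := 0)).continuous
    fun_prop

theorem exp_herglotz_mul_le {δ d q : ℝ} (hδ : 0 < δ) (hδ1 : δ ≤ 1 / 2) (hd : 0 ≤ d)
    (hq : q = (1 - (1 - δ) ^ 2) / ((1 - (1 - δ)) ^ 2 + (1 - δ) * d) - 1) :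
    Real.exp (1 / (256 * δ) * q) * expNegInvGlue (d ^ 2) ≤ Real.exp (-(1 / (512 * δ))) := by
  rcases hd.eq_or_lt with rfl | hd0
  · simp [expNegInvGlue.zero, Real.exp_nonneg]
  have hg : expNegInvGlue (d ^ 2) = Real.exp (-(d ^ 2)⁻¹) := by
    rw [expNegInvGlue, if_neg (not_le.2 (by positivity))]
  have hD : 0 < (1 - (1 - δ)) ^ 2 + (1 - δ) * d := by nlinarith
  rw [hg, ← Real.exp_add, Real.exp_le_exp]
  rcases le_or_gt (8 * δ) d with h | h
  · have h1 : q ≤ -(1 / 2) := by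
      rw [hq, sub_le_iff_le_add, div_le_iff₀ hD]
      nlinarith
    have h2 : 0 ≤ (d ^ 2)⁻¹ := by positivity
    have h3 : 1 / (256 * δ) * q ≤ 1 / (256 * δ) * -(1 / 2) :=
      mul_le_mul_of_nonneg_left h1 (by positivity)
    have h4 : 1 / (256 * δ) * -(1 / 2) = -(1 / (512 * δ)) := by
      field_simp
      norm_num
    linarith
  · have h1 : q ≤ 2 / δ := by
      rw [hq, sub_le_iff_le_add, div_le_iff₀ hD]
      have : (2 / δ + 1) * ((1 - (1 - δ)) ^ 2 + (1 - δ) * d) ≥ 2 / δ * δ ^ 2 := by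
        have h5 : 0 ≤ 2 / δ := by positivity
        nlinarith [mul_nonneg h5 (mul_nonneg (by linarith : 0 ≤ 1 - δ) hd), mul_nonneg (by linarith : 0 ≤ 1 - δ) hd]
      have h6 : 2 / δ * δ ^ 2 = 2 * δ := by field_simp
      nlinarith
    have h2 : (1 / (64 * δ ^ 2)) ≤ (d ^ 2)⁻¹ := by
      rw [← one_div]
      exact one_div_le_one_div_of_le (by positivity) (by nlinarith)
    have h3 : 1 / (256 * δ) * q ≤ 1 / (256 * δ) * (2 / δ) :=
      mul_le_mul_of_nonneg_left h1 (by positivity)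
    have h4 : 1 / (256 * δ) * (2 / δ) = 1 / (128 * δ ^ 2) := by
      field_simp
      norm_num
    have h5 : 1 / (64 * δ ^ 2) = 1 / (128 * δ ^ 2) + 1 / (128 * δ ^ 2) := by
      field_simp
      norm_num
    have h6 : 1 / (512 * δ) ≤ 1 / (128 * δ ^ 2) :=
      one_div_le_one_div_of_le (by positivity) (by nlinarith)
    linarith

theorem exists_norm_add_mul_flat_le {ε : ℝ} (hε : 0 < ε) :
    ∃ ζ ∈ diskIdeal, ‖flat + ζ * flat‖ ≤ ε := by
  obtain ⟨m, hm⟩ := ((Real.tendsto_exp_neg_atTop_nhds_zero.comp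
    tendsto_natCast_atTop_atTop).eventually (gt_mem_nhds hε)).and (eventually_ge_atTop 1) |>.exists
  obtain ⟨hm, hm1⟩ := hm
  have hm1' : (1 : ℝ) ≤ m := by exact_mod_cast hm1
  have hm0 : (0 : ℝ) < m := by linarith
  set δ : ℝ := 1 / (512 * m) with hδ
  have hδ0 : 0 < δ := by positivity
  have hδ1 : δ ≤ 1 / 2 := one_div_le_one_div_of_le (by norm_num) (by linarith)
  have hδm : 1 / (512 * δ) = m := by rw [hδ]; field_simp
  obtain ⟨Q, hQ, hQx⟩ := exists_herglotz_mem_diskIdeal (r := 1 - δ) (by linarith) (by linarith)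
  set t : ℝ := 1 / (256 * δ)
  refine ⟨NormedSpace.exp ((t : ℂ) • Q) - 1,
    exp_sub_one_mem_diskIdeal (Submodule.smul_mem _ _ hQ), ?_⟩
  rw [sub_mul, one_mul, add_sub_cancel, ContinuousMap.norm_le _ hε.le]
  intro x
  have hexp : NormedSpace.exp ((t : ℂ) • Q) x = Complex.exp (t * Q x) := by
    have := NormedSpace.map_exp (ContinuousMap.evalAlgHom ℂ ℂ x)
      (continuous_eval_const x) ((t : ℂ) • Q)
    rw [Complex.exp_eq_exp_ℂ]
    exact this
  rw [ContinuousMap.mul_apply, norm_mul, hexp, Complex.norm_exp, Complex.re_ofReal_mul]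
  have hfx : ‖flat x‖ = expNegInvGlue ((‖1 - fourier 1 x‖ ^ 2) ^ 2) := by
    rw [flat, ContinuousMap.coe_mk, Complex.norm_real,
      Real.norm_of_nonneg (expNegInvGlue.nonneg _), ← pow_mul]
  have h := exp_herglotz_mul_le hδ0 hδ1 (sq_nonneg ‖1 - fourier 1 x‖)
    (re_herglotz (by linarith) (by linarith) (norm_fourier_one_apply x) (hQx x))
  rw [hfx]
  rw [hδm] at h
  exact h.trans hm.le

open Polynomial in
theorem flat_mem_closure : flat ∈ closure (Set.range fun p : ℂ[X] =>
    aeval (fourier 1 : C(UnitAddCircle, ℂ)) (X * p) * flat) := by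
  rw [← closure_closure, Metric.mem_closure_iff]
  intro ε hε
  obtain ⟨ζ, hζ, h⟩ := exists_norm_add_mul_flat_le (half_pos hε)
  refine ⟨-ζ * flat, ?_, ?_⟩
  · have hζ' := diskIdeal.neg_mem hζ
    rw [← SetLike.mem_coe, coe_diskIdeal] at hζ'
    refine map_mem_closure (f := fun h => h * flat) (by fun_prop) hζ' ?_
    rintro _ ⟨p, rfl⟩
    exact ⟨p, rfl⟩
  · have h1 : flat - -ζ * flat = flat + ζ * flat := by ring
    rw [dist_eq_norm, h1]
    linarith

theorem fourier_one_pow (n : ℕ) :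
    (fourier 1 : C(UnitAddCircle, ℂ)) ^ n = fourier (n : ℤ) := by
  induction n with
  | zero => ext x; simp
  | succ n ih =>
    ext x
    rw [pow_succ, ih, Nat.cast_succ, ContinuousMap.mul_apply, fourier_add]

theorem flat_ne_zero {x : UnitAddCircle} (hx : x ≠ 0) : flat x ≠ 0 := by
  have h1 : 1 - fourier 1 x ≠ 0 := by
    rw [sub_ne_zero]
    intro h
    apply hx
    apply AddCircle.injective_toCircle one_ne_zero
    ext
    simpa using h.symm
  have h2 : 0 < ‖1 - fourier 1 x‖ ^ 4 := by positivity
  exact Complex.ofReal_ne_zero.2 (expNegInvGlue.pos_of_pos h2).ne'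

open Polynomial in
theorem eq_zero_of_forall_aeval_mul_flat_eq_zero (L : C(UnitAddCircle, ℂ) →L[ℂ] ℂ)
    (hL : ∀ p : ℂ[X], L (aeval (fourier 1 : C(UnitAddCircle, ℂ)) p * flat) = 0)
    (f : C(UnitAddCircle, ℂ)) (hf : f 0 = 0) : L f = 0 := by
  have hneg : ∀ (n : ℕ) (p : ℂ[X]),
      L (fourier (-(n : ℤ)) * (aeval (fourier 1 : C(UnitAddCircle, ℂ)) p * flat)) = 0 := by
    intro n
    induction n with
    | zero =>
      intro p
      have h0 : (fourier (-((0 : ℕ) : ℤ)) : C(UnitAddCircle, ℂ)) = 1 := by ext x; simp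
      rw [h0, one_mul, hL]
    | succ n ih =>
      intro p
      have hc : Continuous fun h : C(UnitAddCircle, ℂ) => L (fourier (-((n + 1 : ℕ) : ℤ)) *
          (aeval (fourier 1 : C(UnitAddCircle, ℂ)) p * h)) := by fun_prop
      have hz : (fourier (-((n + 1 : ℕ) : ℤ)) * fourier 1 : C(UnitAddCircle, ℂ)) =
          fourier (-(n : ℤ)) := by
        ext x
        rw [ContinuousMap.mul_apply, ← fourier_add]
        congr 2
        push_cast
        ring
      refine (isClosed_singleton.preimage hc).closure_subset_iff.2 ?_ flat_mem_closure
      rintro _ ⟨q, rfl⟩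
      show L _ = 0
      rw [← ih (p * q), ← hz]
      simp only [map_mul, aeval_X]
      congr 1
      ring
  have hall : ∀ (n : ℤ), L (fourier n * flat) = 0 := by
    intro n
    obtain ⟨k, rfl | rfl⟩ := n.eq_nat_or_neg
    · simpa [← fourier_one_pow] using hL (X ^ k)
    · simpa using hneg k 1
  have hmul : ∀ h : C(UnitAddCircle, ℂ), L (h * flat) = 0 := by
    intro h
    have hh : h ∈ (Submodule.span ℂ (Set.range (fourier (T := 1)))).topologicalClosure := by
      rw [span_fourier_closure_eq_top]; trivial
    let L' : C(UnitAddCircle, ℂ) →L[ℂ] ℂ :=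
      L.comp ((ContinuousLinearMap.mul ℂ C(UnitAddCircle, ℂ)).flip flat)
    have : (Submodule.span ℂ (Set.range (fourier (T := 1)))).topologicalClosure ≤
        LinearMap.ker L'.toLinearMap := by
      refine Submodule.topologicalClosure_minimal _ (Submodule.span_le.2 ?_) L'.isClosed_ker
      rintro _ ⟨n, rfl⟩
      exact hall n
    exact this hh
  let I : Ideal C(UnitAddCircle, ℂ) :=
    { carrier := {k | ∀ h, L (h * k) = 0}
      add_mem' := fun ha hb h => by rw [mul_add, map_add, ha h, hb h, add_zero]
      zero_mem' := fun h => by rw [mul_zero, map_zero]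
      smul_mem' := fun c k hk h => by rw [smul_eq_mul, ← mul_assoc, hk] }
  have hI : IsClosed (I : Set C(UnitAddCircle, ℂ)) := by
    have : (I : Set C(UnitAddCircle, ℂ)) = ⋂ h, {k | L (h * k) = 0} := by
      ext; simp [I]
    rw [this]
    exact isClosed_iInter fun h => isClosed_eq (by fun_prop) continuous_const
  have hfI : f ∈ I := by
    rw [← ContinuousMap.idealOfSet_ofIdeal_isClosed hI, ContinuousMap.mem_idealOfSet]
    intro x hx
    by_cases hx0 : x = 0
    · rw [hx0, hf]
    · exact absurd (ContinuousMap.mem_setOfIdeal.2 ⟨flat, show flat ∈ I from hmul, flat_ne_zero hx0⟩) hx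
  simpa using hfI 1

theorem inner_evec {V : Type*} (u : V) (x : lp (fun _ : V => ℂ) 2) : inner ℂ (evec u) x = x u := by
  classical
  have : (evec u : lp (fun _ : V => ℂ) 2) = lp.single 2 u 1 := by
    unfold evec
    congr!
  rw [this, lp.inner_single_left]
  simp

theorem evec_apply {V : Type*} [DecidableEq V] (u w : V) :
    (evec u : lp (fun _ : V => ℂ) 2) w = if w = u then 1 else 0 := by
  have : (evec u : lp (fun _ : V => ℂ) 2) = lp.single 2 u 1 := by
    unfold evec
    congr!
  rw [this, lp.coeFn_single, Pi.single_apply]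

theorem orthonormal_evec {V : Type*} : Orthonormal ℂ (evec : V → lp (fun _ : V => ℂ) 2) := by
  classical
  rw [orthonormal_iff_ite]
  intro u w
  rw [inner_evec, evec_apply]

theorem exists_diagonal_fourier {H : Type*} [NormedAddCommGroup H] [InnerProductSpace ℂ H]
    [CompleteSpace H] {e : ℤ → H} (he : Orthonormal ℂ e) {a : ℤ → ℝ}
    (ha0 : ∀ n, 0 < a n) (ha1 : ∀ n, a n ≤ 1) :
    ∃ J : C(UnitAddCircle, ℂ) →L[ℂ] H, ∀ n : ℤ, J (fourier n) = (a n : ℂ) • e n := by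
  classical
  let D : lp (fun _ : ℤ => ℂ) 2 →L[ℂ] lp (fun _ : ℤ => ℂ) 2 :=
    lp.mapCLM 2 (fun n => (a n : ℂ) • ContinuousLinearMap.id ℂ ℂ) zero_le_one fun n => by
      rw [norm_smul, Complex.norm_real, Real.norm_of_nonneg (ha0 n).le,
        ContinuousLinearMap.norm_id, mul_one]
      exact ha1 n
  let J : C(UnitAddCircle, ℂ) →L[ℂ] H :=
    he.orthogonalFamily.linearIsometry.toContinuousLinearMap ∘L D ∘L
      (fourierBasis (T := 1)).repr.toContinuousLinearEquiv.toContinuousLinearMap ∘L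
      ContinuousMap.toLp 2 AddCircle.haarAddCircle ℂ
  refine ⟨J, fun n => ?_⟩
  have h1 : ContinuousMap.toLp 2 AddCircle.haarAddCircle ℂ (fourier n) =
      fourierBasis (T := 1) n := by
    rw [coe_fourierBasis]
  have h2 : D (lp.single 2 n 1) = lp.single 2 n (a n : ℂ) := by
    ext m
    simp only [D, lp.mapCLM_apply_coe]
    by_cases h : m = n
    · subst h; simp
    · simp [h]
  simp only [J, ContinuousLinearMap.comp_apply, h1]
  have h3 : (fourierBasis (T := 1)).repr.toContinuousLinearEquiv.toContinuousLinearMap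
      (fourierBasis (T := 1) n) = lp.single 2 n 1 := (fourierBasis (T := 1)).repr_self n
  rw [h3, h2]
  exact (he.orthogonalFamily.linearIsometry_apply_single _).trans (by simp)

open Polynomial in
theorem exists_cyclic_for_bilateral {H : Type*} [NormedAddCommGroup H] [InnerProductSpace ℂ H]
    [CompleteSpace H] (T : H →L[ℂ] H) {e : ℤ → H} (he : Orthonormal ℂ e) {a : ℤ → ℝ}
    (ha0 : ∀ n, 0 < a n) (ha1 : ∀ n, a n ≤ 1)
    (hT : ∀ n, T ((a n : ℂ) • e n) = (a (n + 1) : ℂ) • e (n + 1)) :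
    ∃ b, b ∈ closure (Set.range fun p : ℂ[X] => aeval T (X * p) b) ∧
      ∀ n, e n ∈ closure (Set.range fun p : ℂ[X] => aeval T p b) := by
  obtain ⟨J, hJ⟩ := exists_diagonal_fourier he ha0 ha1
  have hTJ : ∀ f, T (J f) = J (fourier 1 * f) := by
    let L : C(UnitAddCircle, ℂ) →L[ℂ] H :=
      T ∘L J - J ∘L (ContinuousLinearMap.mul ℂ C(UnitAddCircle, ℂ) (fourier 1))
    have hle : (Submodule.span ℂ (Set.range (fourier (T := 1)))).topologicalClosure ≤
        LinearMap.ker L.toLinearMap := by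
      refine Submodule.topologicalClosure_minimal _ (Submodule.span_le.2 ?_) L.isClosed_ker
      rintro _ ⟨n, rfl⟩
      have hz : (fourier 1 * fourier n : C(UnitAddCircle, ℂ)) = fourier (n + 1) := by
        ext x
        rw [ContinuousMap.mul_apply, ← fourier_add, add_comm]
      show T (J (fourier n)) - J (fourier 1 * fourier n) = 0
      rw [hz, hJ, hJ, hT, sub_self]
    intro f
    rw [span_fourier_closure_eq_top] at hle
    exact sub_eq_zero.1 (hle (Submodule.mem_top (x := f)))
  have hpJ : ∀ (p : ℂ[X]) f,
      aeval T p (J f) = J (aeval (fourier 1 : C(UnitAddCircle, ℂ)) p * f) := by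
    intro p
    induction p using Polynomial.induction_on' with
    | add p q hp hq => intro f; simp [hp, hq, add_mul]
    | monomial n c =>
      intro f
      have hn : ∀ n : ℕ, (T ^ n) (J f) = J (fourier 1 ^ n * f) := by
        intro n
        induction n with
        | zero => simp
        | succ n ih =>
          rw [pow_succ', mul_apply_eq_comp, ih, hTJ, pow_succ', mul_assoc]
      simp [aeval_monomial, Algebra.algebraMap_eq_smul_one, hn]
  refine ⟨J flat, ?_, fun n => ?_⟩
  · refine map_mem_closure J.continuous flat_mem_closure ?_
    rintro _ ⟨p, rfl⟩
    exact ⟨p, hpJ _ _⟩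
  · let R : Submodule ℂ H := LinearMap.range
      ((ContinuousLinearMap.apply ℂ H (J flat)).toLinearMap ∘ₗ (aeval T).toLinearMap)
    have hR : (R.topologicalClosure : Set H) =
        closure (Set.range fun p : ℂ[X] => aeval T p (J flat)) := by
      rw [Submodule.topologicalClosure_coe, LinearMap.coe_range]
      rfl
    rw [← hR, SetLike.mem_coe, ← Submodule.orthogonal_orthogonal_eq_closure]
    intro y hy
    have hL := eq_zero_of_forall_aeval_mul_flat_eq_zero (innerSL ℂ y ∘L J) fun p => by
      rw [ContinuousLinearMap.comp_apply, ← hpJ]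
      exact (Submodule.mem_orthogonal' R y).1 hy _ ⟨p, rfl⟩
    have hk : ∀ k : ℕ, (a n : ℂ) * inner ℂ y (e n) =
        (a (n + k) : ℂ) * inner ℂ y (e (n + k)) := by
      intro k
      have h := hL (fourier n - fourier (n + k)) (by simp)
      simp only [ContinuousLinearMap.comp_apply, map_sub, hJ, map_smul, innerSL_apply_apply,
        smul_eq_mul] at h
      exact sub_eq_zero.1 h
    have hlim : Tendsto (fun k : ℕ => (a (n + k) : ℂ) * inner ℂ y (e (n + k))) atTop (𝓝 0) := by
      have hinj : Function.Injective fun k : ℕ => n + (k : ℤ) := fun i j h => by simpa using h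
      have h1 := ((he.comp _ hinj).inner_products_summable y).tendsto_atTop_zero.sqrt
      rw [Real.sqrt_zero] at h1
      refine squeeze_zero_norm (fun k => ?_) h1
      rw [norm_mul, Complex.norm_real, Real.norm_of_nonneg (ha0 _).le, Function.comp_apply,
        Real.sqrt_sq (norm_nonneg _), norm_inner_symm]
      exact mul_le_of_le_one_left (norm_nonneg _) (ha1 _)
    have h0 := tendsto_nhds_unique (tendsto_const_nhds.congr hk) hlim
    exact (mul_eq_zero.1 h0).resolve_left (by exact_mod_cast (ha0 n).ne')

theorem iterate_parent_ne {V : Type*} {E : V → V → Prop} (hloop : ∀ v, ¬ E v v)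
    (hcirc : ∀ (n : ℕ) (f : Fin (n + 2) → V), Function.Injective f →
      ¬ ((∀ i : Fin (n + 1), E (f i.castSucc) (f i.succ)) ∧ E (f (Fin.last (n + 1))) (f 0)))
    {P : V → V} (hP : ∀ v, E (P v) v) (u : V) {n : ℕ} (hn : 0 < n) : P^[n] u ≠ u := by
  intro hu
  have hm0 := Function.IsPeriodicPt.minimalPeriod_pos hn hu
  obtain ⟨k, hk⟩ | h1 : (∃ k, Function.minimalPeriod P u = k + 2) ∨
      Function.minimalPeriod P u = 1 := by
    rcases h : Function.minimalPeriod P u with _ | _ | k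
    · omega
    · exact Or.inr rfl
    · exact Or.inl ⟨k, rfl⟩
  · have hinj := Function.iterate_injOn_Iio_minimalPeriod (f := P) (x := u)
    refine hcirc k (fun i => P^[k + 1 - i] u) ?_ ⟨fun i => ?_, ?_⟩
    · intro i j hij
      have := hinj (by rw [Set.mem_Iio]; omega) (by rw [Set.mem_Iio]; omega) hij
      ext
      omega
    · have hi : k + 1 - (i.castSucc : Fin (k + 2)).val = (k + 1 - (i.succ).val) + 1 := by
        simp only [Fin.val_castSucc, Fin.val_succ]
        omega
      simp only [hi, Function.iterate_succ_apply']
      exact hP _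
    · have h := hP (P^[k + 1] u)
      rw [← Function.iterate_succ_apply' (f := P), show (k + 1).succ = Function.minimalPeriod P u from hk.symm,
        Function.iterate_minimalPeriod] at h
      simpa using h
  · have h := Function.iterate_minimalPeriod (f := P) (x := u)
    rw [h1, Function.iterate_one] at h
    have := hP u
    rw [h] at this
    exact hloop u this

theorem exists_forall_descendant_subsingleton {V : Type*} [Nonempty V] {E : V → V → Prop}
    (hpar : ∀ u u' v, E u v → E u' v → u = u') {P : V → V} (hP : ∀ v, E (P v) v)
    (hacyc : ∀ u n, 0 < n → P^[n] u ≠ u) (hleaf : ∀ u, ∃ v, E u v)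
    (hfin : {u : V | ¬ {v | E u v}.Subsingleton}.Finite) :
    ∃ u, ∀ w, Relation.ReflTransGen E u w → {v | E w v}.Subsingleton := by
  let β : V → Set V := fun u => {w | ¬ {v | E w v}.Subsingleton ∧ Relation.ReflTransGen E u w}
  have hβ : ∀ u, (β u).Finite := fun u => hfin.subset fun w hw => hw.1
  suffices h : ∀ k u, (β u).ncard = k →
      ∃ u, ∀ w, Relation.ReflTransGen E u w → {v | E w v}.Subsingleton from
    h _ (Classical.arbitrary V) rfl
  intro k
  induction k using Nat.strong_induction_on with
  | _ k ih =>
    intro u hu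
    by_cases hne : (β u).Nonempty
    · obtain ⟨w, hw⟩ := hne
      obtain ⟨w', hw'⟩ := hleaf w
      refine ih _ (hu ▸ Set.ncard_lt_ncard ?_ (hβ u)) w' rfl
      have hsub : β w' ⊆ β u := fun x hx => ⟨hx.1, (hw.2.tail hw').trans hx.2⟩
      refine (Set.ssubset_iff_of_subset hsub).2
        ⟨w, hw, fun hww => ?_⟩
      have hanc : ∀ x, Relation.ReflTransGen E w' x → ∃ n, P^[n] x = w' := by
        intro x hx
        induction hx with
        | refl => exact ⟨0, rfl⟩
        | @tail y z _ hyz ihy =>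
          obtain ⟨n, hn⟩ := ihy
          exact ⟨n + 1, by rw [Function.iterate_succ_apply, hpar _ _ _ (hP z) hyz, hn]⟩
      obtain ⟨n, hn⟩ := hanc w hww.2
      refine hacyc w (n + 1) n.succ_pos ?_
      rw [Function.iterate_succ_apply', hn, hpar _ _ _ (hP w') hw']
    · refine ⟨u, fun w hw => ?_⟩
      by_contra hs
      exact hne ⟨w, hs, hw⟩

theorem exists_biinfinite_path {V : Type*} [Nonempty V] {E : V → V → Prop}
    (hE : IsDirectedTree E) (hroot : ∀ v, ∃ u, E u v) (hleaf : ∀ u, ∃ v, E u v)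
    (hfin : {u : V | ¬ {v | E u v}.Subsingleton}.Finite) :
    ∃ v : ℤ → V, Function.Injective v ∧ (∀ n, E (v (n + 1)) (v n)) ∧
      ∀ n : ℕ, {w | E (v (-n)) w}.Subsingleton := by
  obtain ⟨hloop, hpar, -, hcirc⟩ := hE
  choose P hP using hroot
  choose c hc using hleaf
  have hacyc : ∀ u n, 0 < n → P^[n] u ≠ u := fun u n hn => iterate_parent_ne hloop hcirc hP u hn
  obtain ⟨u, hu⟩ := exists_forall_descendant_subsingleton hpar hP hacyc (fun u => ⟨c u, hc u⟩) hfin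
  let v : ℤ → V
    | Int.ofNat n => P^[n] u
    | Int.negSucc n => c^[n + 1] u
  have hv : ∀ n, E (v (n + 1)) (v n) := by
    rintro (n | n)
    · show E (P^[n + 1] u) (P^[n] u)
      rw [Function.iterate_succ_apply']
      exact hP _
    · rcases n with _ | n
      · exact hc u
      · show E (c^[n + 1] u) (c^[n + 1 + 1] u)
        rw [Function.iterate_succ_apply' c (n + 1)]
        exact hc _
  refine ⟨v, ?_, hv, fun n => hu _ ?_⟩
  · have hk : ∀ (k : ℕ) n, P^[k] (v n) = v (n + k) := by
      intro k
      induction k with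
      | zero => intro n; simp
      | succ k ih =>
        intro n
        rw [Function.iterate_succ_apply, hpar _ _ _ (hP (v n)) (hv n), ih]
        congr 1
        push_cast
        ring
    have hle : ∀ m n, m ≤ n → v m = v n → m = n := by
      intro m n hmn h
      obtain ⟨k, rfl⟩ := Int.le.dest hmn
      rcases Nat.eq_zero_or_pos k with rfl | hk0
      · simp
      · exact absurd ((hk k m).trans h.symm) (hacyc _ k hk0)
    intro m n h
    rcases le_total m n with hmn | hmn
    · exact hle m n hmn h
    · exact (hle n m hmn h.symm).symm
  · induction n with
    | zero => exact Relation.ReflTransGen.refl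
    | succ n ih =>
      refine ih.tail ?_
      have := hv (-((n + 1 : ℕ) : ℤ))
      rwa [show -((n + 1 : ℕ) : ℤ) + 1 = -(n : ℤ) by push_cast; ring] at this

theorem exists_weight_quotients {L : ℤ → ℝ} (hL0 : ∀ n, 0 < L n) (hL1 : ∀ n, L n ≤ 1)
    (hlim : ¬ Tendsto (fun j : ℕ => ∏ k ∈ Finset.range j, L (-1 - k)) atTop (𝓝 0)) :
    ∃ a : ℤ → ℝ, (∀ n, 0 < a n) ∧ (∀ n, a n ≤ 1) ∧ ∀ n, a (n + 1) = L n * a n := by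
  let p : ℤ → ℕ → ℝ := fun n j => ∏ k ∈ Finset.range j, L (n - 1 - k)
  have hp0 : ∀ n j, 0 < p n j := fun n j => Finset.prod_pos fun k _ => hL0 _
  have hbdd : ∀ n, BddBelow (Set.range (p n)) := fun n =>
    ⟨0, by rintro _ ⟨j, rfl⟩; exact (hp0 n j).le⟩
  have hanti : ∀ n, Antitone (p n) := fun n => antitone_nat_of_succ_le fun j => by
    simp only [p, Finset.prod_range_succ]
    exact mul_le_of_le_one_right (hp0 n j).le (hL1 _)
  have ht : ∀ n, Tendsto (p n) atTop (𝓝 (⨅ j, p n j)) := fun n =>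
    tendsto_atTop_ciInf (hanti n) (hbdd n)
  have hrec : ∀ n, (⨅ j, p (n + 1) j) = L n * ⨅ j, p n j := fun n => by
    refine tendsto_nhds_unique ((ht (n + 1)).comp (tendsto_add_atTop_nat 1))
      (((ht n).const_mul (L n)).congr fun j => ?_)
    simp only [p, Function.comp_apply, Finset.prod_range_succ']
    rw [mul_comm]
    congr 1
    · refine Finset.prod_congr rfl fun k _ => ?_
      congr 1
      push_cast
      ring
    · congr 1
      push_cast
      ring
  refine ⟨fun n => ⨅ j, p n j, fun n => ?_, fun n => ?_, hrec⟩
  · refine (le_ciInf fun j => (hp0 n j).le).lt_of_ne' ?_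
    induction n using Int.induction_on with
    | zero =>
      intro h
      apply hlim
      have h0 := ht 0
      rw [h] at h0
      simpa [p] using h0
    | succ n ih => rw [hrec]; exact mul_ne_zero (hL0 _).ne' ih
    | pred n ih =>
      have h := hrec (-(n : ℤ) - 1)
      rw [sub_add_cancel] at h
      rw [h] at ih
      exact right_ne_zero_of_mul ih
  · exact (ciInf_le (hbdd n) 0).trans (by simp [p])

theorem countable_of_connected {V : Type*} {E : V → V → Prop}
    (hpar : ∀ u u' v, E u v → E u' v → u = u')
    (hconn : ∀ u v : V, Relation.ReflTransGen (fun a b => E a b ∨ E b a) u v)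
    (hchi : ∀ u, {v | E u v}.Countable) : Countable V := by
  rcases isEmpty_or_nonempty V with _ | ⟨⟨u⟩⟩
  · infer_instance
  let D : ℕ → Set V := fun n => (fun W : Set V => ⋃ x ∈ W, {y | E x y ∨ E y x})^[n] {u}
  have hD : ∀ n, (D n).Countable := by
    intro n
    induction n with
    | zero => exact Set.countable_singleton u
    | succ n ih =>
      simp only [D, Function.iterate_succ_apply'] at ih ⊢
      exact ih.biUnion fun x _ => (hchi x).union
        (Set.Subsingleton.countable fun y hy z hz => hpar _ _ _ hy hz)
  have h : ∀ w, ∃ n, w ∈ D n := by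
    intro w
    induction hconn u w with
    | refl => exact ⟨0, rfl⟩
    | @tail x y _ hxy ih =>
      obtain ⟨n, hn⟩ := ih
      refine ⟨n + 1, ?_⟩
      simp only [D, Function.iterate_succ_apply'] at hn ⊢
      exact Set.mem_biUnion hn hxy
  rw [← Set.countable_univ_iff]
  exact (Set.countable_iUnion hD).mono fun w _ => Set.mem_iUnion.2 (h w)

theorem countable_setOf_apply_ne_zero {V : Type*} (x : lp (fun _ : V => ℂ) 2) :
    {v | x v ≠ 0}.Countable := by
  have h := (orthonormal_evec.inner_products_summable x).countable_support
  refine h.mono fun v hv => ?_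
  simpa [inner_evec] using hv

open Polynomial in
theorem isCyclicVector_of_forall_evec_mem {V : Type*}
    (T : lp (fun _ : V => ℂ) 2 →L[ℂ] lp (fun _ : V => ℂ) 2) (f : lp (fun _ : V => ℂ) 2)
    (h : ∀ u, evec u ∈ closure (Set.range fun p : ℂ[X] => aeval T p f)) :
    IsCyclicVector T f := by
  set R := Submodule.span ℂ (Set.range fun n : ℕ => (T ^ n) f) with hR
  have hmem : ∀ p : ℂ[X], aeval T p f ∈ R := by
    intro p
    induction p using Polynomial.induction_on' with
    | add p q hp hq => simpa using R.add_mem hp hq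
    | monomial n c =>
      have : (T ^ n) f ∈ R := Submodule.subset_span ⟨n, rfl⟩
      simpa [aeval_monomial, Algebra.algebraMap_eq_smul_one] using R.smul_mem c this
  rw [IsCyclicVector, ← hR, Submodule.topologicalClosure_eq_top_iff, Submodule.eq_bot_iff]
  intro y hy
  ext u
  rw [← Submodule.orthogonal_closure] at hy
  rw [← inner_evec]
  refine hy _ ?_
  rw [← SetLike.mem_coe, Submodule.topologicalClosure_coe]
  exact closure_mono (Set.range_subset_iff.2 hmem) (h u)

/-- The vectors annihilated by some power of `T`. -/
def nilpotentVectors {H : Type*} [NormedAddCommGroup H] [NormedSpace ℂ H] (T : H →L[ℂ] H) :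
    Submodule ℂ H where
  carrier := {x | ∃ n : ℕ, (T ^ n) x = 0}
  add_mem' := by
    rintro x y ⟨m, hm⟩ ⟨n, hn⟩
    refine ⟨m + n, ?_⟩
    rw [map_add]
    nth_rw 1 [pow_add, pow_mul_comm]
    rw [pow_add, mul_apply_eq_comp, mul_apply_eq_comp, hm, hn, map_zero, map_zero, add_zero]
  zero_mem' := ⟨0, map_zero _⟩
  smul_mem' := by
    rintro c x ⟨n, hn⟩
    exact ⟨n, by rw [map_smul, hn, smul_zero]⟩

theorem apply_mem_nilpotentVectors_iff {H : Type*} [NormedAddCommGroup H] [NormedSpace ℂ H]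
    {T : H →L[ℂ] H} {x : H} : T x ∈ nilpotentVectors T ↔ x ∈ nilpotentVectors T := by
  constructor
  · rintro ⟨n, hn⟩
    exact ⟨n + 1, by rw [pow_succ]; exact hn⟩
  · rintro ⟨n, hn⟩
    refine ⟨n, ?_⟩
    rw [← mul_apply_eq_comp, ← pow_succ, pow_succ', mul_apply_eq_comp, hn, map_zero]

open Polynomial in
theorem exists_isCyclicVector_of_sub_mem_nilpotentVectors {V : Type*} [Countable V]
    (T : lp (fun _ : V => ℂ) 2 →L[ℂ] lp (fun _ : V => ℂ) 2)
    (hsurj : ∀ u, ∃ w, ∃ c : ℂ, T (c • evec w) = evec u) (b : lp (fun _ : V => ℂ) 2)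
    (hb : b ∈ closure (Set.range fun p : ℂ[X] => aeval T (X * p) b))
    (G : Set V) (hG : ∀ v ∈ G, evec v ∈ closure (Set.range fun p : ℂ[X] => aeval T p b))
    (hV : ∀ u, evec u ∈ nilpotentVectors T ∨
      ∃ v ∈ G, ∃ c : ℂ, evec u - c • evec v ∈ nilpotentVectors T) :
    ∃ f, IsCyclicVector T f := by
  let F : Submodule ℂ (lp (fun _ : V => ℂ) 2) := Submodule.span ℂ (Set.range evec)
  have hF : ∀ u, evec u ∈ F := fun u => Submodule.subset_span ⟨u, rfl⟩
  have hFT : F ≤ F.map T.toLinearMap := by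
    refine Submodule.span_le.2 ?_
    rintro _ ⟨u, rfl⟩
    obtain ⟨w, c, h⟩ := hsurj u
    exact ⟨c • evec w, F.smul_mem c (hF w), h⟩
  have hK : ∀ s ∈ F ⊓ nilpotentVectors T, ∃ w ∈ F ⊓ nilpotentVectors T, T w = s := by
    intro s hs
    obtain ⟨w, hw, rfl⟩ := hFT hs.1
    exact ⟨w, ⟨hw, apply_mem_nilpotentVectors_iff.1 hs.2⟩, rfl⟩
  have hy : ∀ u, ∃ s ∈ F ⊓ nilpotentVectors T,
      evec u - s ∈ closure (Set.range fun p : ℂ[X] => aeval T p b) := by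
    intro u
    rcases hV u with h | ⟨v, hv, c, h⟩
    · exact ⟨_, ⟨hF u, h⟩, subset_closure ⟨0, by simp⟩⟩
    · refine ⟨_, ⟨F.sub_mem (hF u) (F.smul_mem c (hF v)), h⟩, ?_⟩
      rw [sub_sub_cancel]
      refine map_mem_closure (continuous_const_smul c) (hG v hv) ?_
      rintro _ ⟨p, rfl⟩
      exact ⟨c • p, by simp⟩
  obtain ⟨f, hf⟩ := exists_forall_mem_closure_orbit T b (F ⊓ nilpotentVectors T)
    (fun s hs => hs.2) hK hb evec hy
  exact ⟨f, isCyclicVector_of_forall_evec_mem T f hf⟩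

section AdjointShift

variable {V : Type*} {E : V → V → Prop} {lam : V → ℝ}
  {S : lp (fun _ : V => ℂ) 2 →L[ℂ] lp (fun _ : V => ℂ) 2}

theorem adjoint_shift_evec_apply
    (hS : ∀ u v : V, (S (evec u)) v = Set.indicator {w | E u w} (fun w => (lam w : ℂ)) v)
    (u w : V) : (ContinuousLinearMap.adjoint S (evec u)) w =
      Set.indicator {x | E x u} (fun _ => (lam u : ℂ)) w := by
  classical
  rw [← inner_evec, ContinuousLinearMap.adjoint_inner_right, ← inner_conj_symm, inner_evec, hS]
  by_cases h : E w u <;> simp [Set.indicator, h]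

theorem adjoint_shift_evec_of_edge (hpar : ∀ u u' v, E u v → E u' v → u = u')
    (hS : ∀ u v : V, (S (evec u)) v = Set.indicator {w | E u w} (fun w => (lam w : ℂ)) v)
    {w u : V} (h : E w u) : ContinuousLinearMap.adjoint S (evec u) = (lam u : ℂ) • evec w := by
  classical
  ext x
  rw [adjoint_shift_evec_apply hS, lp.coeFn_smul, Pi.smul_apply, evec_apply]
  by_cases hx : x = w
  · subst hx; simp [h]
  · have : ¬ E x u := fun hxu => hx (hpar _ _ _ hxu h)
    simp [hx, this]

theorem adjoint_shift_evec_of_root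
    (hS : ∀ u v : V, (S (evec u)) v = Set.indicator {w | E u w} (fun w => (lam w : ℂ)) v)
    {u : V} (h : ∀ w, ¬ E w u) : ContinuousLinearMap.adjoint S (evec u) = 0 := by
  ext x
  rw [adjoint_shift_evec_apply hS]
  simp [h]

theorem norm_evec (u : V) : ‖(evec u : lp (fun _ : V => ℂ) 2)‖ = 1 := orthonormal_evec.1 u

theorem shift_evec_of_subsingleton
    (hS : ∀ u v : V, (S (evec u)) v = Set.indicator {w | E u w} (fun w => (lam w : ℂ)) v)
    {u w : V} (h : E u w) (hu : {x | E u x}.Subsingleton) :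
    S (evec u) = (lam w : ℂ) • evec w := by
  classical
  ext x
  rw [hS, lp.coeFn_smul, Pi.smul_apply, evec_apply]
  by_cases hx : x = w
  · subst hx; simp [h]
  · have : ¬ E u x := fun hxu => hx (hu hxu h)
    simp [hx, this]

theorem exists_child_of_shift_injective
    (hS : ∀ u v : V, (S (evec u)) v = Set.indicator {w | E u w} (fun w => (lam w : ℂ)) v)
    (hC1 : ∀ x : lp (fun _ : V => ℂ) 2,
      Tendsto (fun n : ℕ => ‖(S ^ n) x‖) atTop (𝓝 0) → x = 0) (u : V) : ∃ v, E u v := by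
  by_contra! h
  have h0 : S (evec u) = 0 := by
    ext v
    simp [hS, h]
  refine (norm_ne_zero_iff.1 (by rw [norm_evec]; exact one_ne_zero)) (hC1 (evec u) ?_)
  refine (tendsto_add_atTop_iff_nat 1).1 (tendsto_const_nhds.congr fun n => ?_)
  rw [pow_succ, mul_apply_eq_comp, h0, map_zero, norm_zero]

theorem weight_le_one (hpar : ∀ u u' v, E u v → E u' v → u = u')
    (hS : ∀ u v : V, (S (evec u)) v = Set.indicator {w | E u w} (fun w => (lam w : ℂ)) v)
    (hcon : ‖S‖ ≤ 1) {u w : V} (h : E u w) : lam w ≤ 1 := by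
  have h1 := (ContinuousLinearMap.adjoint S).le_opNorm (evec w)
  rw [adjoint_shift_evec_of_edge hpar hS h, norm_smul, norm_evec, norm_evec, mul_one, mul_one,
    LinearIsometryEquiv.norm_map, Complex.norm_real] at h1
  exact (le_abs_self _).trans (h1.trans hcon)

theorem not_tendsto_prod_weights
    (hS : ∀ u v : V, (S (evec u)) v = Set.indicator {w | E u w} (fun w => (lam w : ℂ)) v)
    (hC1 : ∀ x : lp (fun _ : V => ℂ) 2,
      Tendsto (fun n : ℕ => ‖(S ^ n) x‖) atTop (𝓝 0) → x = 0) {v : ℤ → V}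
    (hlam : ∀ n, 0 < lam (v n)) (hv : ∀ n, E (v (n + 1)) (v n))
    (hsub : ∀ n : ℕ, {w | E (v (-n)) w}.Subsingleton) :
    ¬ Tendsto (fun j : ℕ => ∏ k ∈ Finset.range j, lam (v (-1 - k))) atTop (𝓝 0) := by
  intro h
  have hpow : ∀ j : ℕ, (S ^ j) (evec (v 0)) =
      ((∏ k ∈ Finset.range j, lam (v (-1 - k)) : ℝ) : ℂ) • evec (v (-j)) := by
    intro j
    induction j with
    | zero => simp
    | succ j ih =>
      have hj := hv (-1 - j)
      rw [show (-1 - (j : ℤ)) + 1 = -j by ring] at hj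
      rw [pow_succ', mul_apply_eq_comp, ih, map_smul,
        shift_evec_of_subsingleton hS hj (hsub j), smul_smul, Finset.prod_range_succ]
      push_cast
      rw [show (-1 - (j : ℤ)) = -(j + 1) by ring]
  refine (norm_ne_zero_iff.1 (by rw [norm_evec]; exact one_ne_zero)) (hC1 (evec (v 0)) ?_)
  refine h.congr fun j => ?_
  rw [hpow, norm_smul, norm_evec, mul_one, Complex.norm_real,
    Real.norm_of_nonneg (Finset.prod_nonneg fun k _ => (hlam _).le)]

theorem evec_mem_nilpotentVectors_of_root (hpar : ∀ u u' v, E u v → E u' v → u = u')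
    (hconn : ∀ u v : V, Relation.ReflTransGen (fun a b => E a b ∨ E b a) u v)
    (hlam : ∀ v, (∃ u, E u v) → 0 < lam v)
    (hS : ∀ u v : V, (S (evec u)) v = Set.indicator {w | E u w} (fun w => (lam w : ℂ)) v)
    {r : V} (hr : ∀ u, ¬ E u r) (u : V) :
    evec u ∈ nilpotentVectors (ContinuousLinearMap.adjoint S) := by
  induction hconn r u with
  | refl => exact ⟨1, by simpa using adjoint_shift_evec_of_root hS hr⟩
  | @tail x y _ hxy ih =>
    rcases hxy with h | h
    · rw [← apply_mem_nilpotentVectors_iff, adjoint_shift_evec_of_edge hpar hS h]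
      exact Submodule.smul_mem _ _ ih
    · rw [← apply_mem_nilpotentVectors_iff, adjoint_shift_evec_of_edge hpar hS h,
        Submodule.smul_mem_iff _ (by exact_mod_cast (hlam x ⟨y, h⟩).ne')] at ih
      exact ih

theorem exists_evec_sub_mem_nilpotentVectors (hpar : ∀ u u' v, E u v → E u' v → u = u')
    (hconn : ∀ u v : V, Relation.ReflTransGen (fun a b => E a b ∨ E b a) u v)
    (hlam : ∀ v, (∃ u, E u v) → 0 < lam v)
    (hS : ∀ u v : V, (S (evec u)) v = Set.indicator {w | E u w} (fun w => (lam w : ℂ)) v)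
    {v : ℤ → V} (hv : ∀ n, E (v (n + 1)) (v n)) (u : V) :
    ∃ n, ∃ c : ℂ,
      evec u - c • evec (v n) ∈ nilpotentVectors (ContinuousLinearMap.adjoint S) := by
  have hne : ∀ {x y}, E x y → (lam y : ℂ) ≠ 0 := fun h => by exact_mod_cast (hlam _ ⟨_, h⟩).ne'
  induction hconn (v 0) u with
  | refl => exact ⟨0, 1, by simp⟩
  | @tail x y _ hxy ih =>
    obtain ⟨n, c, ih⟩ := ih
    rcases hxy with h | h
    · have hn := hv (n - 1)
      rw [sub_add_cancel] at hn
      refine ⟨n - 1, lam y * (c * (lam (v (n - 1)) : ℂ)⁻¹), ?_⟩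
      rw [← apply_mem_nilpotentVectors_iff, map_sub, map_smul,
        adjoint_shift_evec_of_edge hpar hS h, adjoint_shift_evec_of_edge hpar hS hn, smul_smul,
        mul_assoc, mul_assoc, inv_mul_cancel₀ (hne hn), mul_one, ← smul_smul, ← smul_sub]
      exact Submodule.smul_mem _ _ ih
    · refine ⟨n + 1, (lam x : ℂ)⁻¹ * (c * lam (v n)), ?_⟩
      rw [← apply_mem_nilpotentVectors_iff, map_sub, map_smul,
        adjoint_shift_evec_of_edge hpar hS h, adjoint_shift_evec_of_edge hpar hS (hv n),
        smul_smul] at ih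
      have := Submodule.smul_mem _ (lam x : ℂ)⁻¹ ih
      rwa [smul_sub, smul_smul, smul_smul, inv_mul_cancel₀ (hne h), one_smul] at this

end AdjointShift

/-- If `S_λ` is a contractive weighted shift of class `C_{1·}` on a directed tree which
either has a root, or is rootless with finite branching index, then `S_λ*` is cyclic. -/
theorem stmt_19 {V : Type*} (E : V → V → Prop) (hE : IsDirectedTree E)
    (lam : V → ℝ) (hlam : ∀ v, (∃ u, E u v) → 0 < lam v)
    (S : lp (fun _ : V => ℂ) 2 →L[ℂ] lp (fun _ : V => ℂ) 2)
    (hS : ∀ u v : V, (S (evec u)) v = Set.indicator {w | E u w} (fun w => (lam w : ℂ)) v)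
    (hcon : ‖S‖ ≤ 1)
    (hC1 : ∀ x : lp (fun _ : V => ℂ) 2,
      Tendsto (fun n : ℕ => ‖(S ^ n) x‖) atTop (𝓝 0) → x = 0)
    (hcase : (∃ r : V, ∀ u, ¬ E u r) ∨
      ((∀ v : V, ∃ u, E u v) ∧
        {u : V | ¬ {v | E u v}.Subsingleton}.Finite ∧ ∀ u : V, {v | E u v}.Finite)) :
    ∃ f, IsCyclicVector (ContinuousLinearMap.adjoint S) f := by
  obtain ⟨hloop, hpar, hconn, hcirc⟩ := id hE
  have hleaf : ∀ u, ∃ v, E u v := exists_child_of_shift_injective hS hC1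
  have hne : ∀ {x y}, E x y → (lam y : ℂ) ≠ 0 := fun h => by exact_mod_cast (hlam _ ⟨_, h⟩).ne'
  have : Countable V := countable_of_connected hpar hconn fun u =>
    (countable_setOf_apply_ne_zero (S (evec u))).mono fun v (hv : E u v) => by
      simpa [hS, hv] using hne hv
  have hsurj : ∀ u, ∃ w, ∃ c : ℂ, ContinuousLinearMap.adjoint S (c • evec w) = evec u := by
    intro u
    obtain ⟨w, hw⟩ := hleaf u
    exact ⟨w, (lam w : ℂ)⁻¹, by
      rw [map_smul, adjoint_shift_evec_of_edge hpar hS hw, smul_smul, inv_mul_cancel₀ (hne hw),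
        one_smul]⟩
  rcases hcase with ⟨r, hr⟩ | ⟨hroot, hfin, -⟩
  · exact exists_isCyclicVector_of_sub_mem_nilpotentVectors _ hsurj 0
      (subset_closure ⟨0, by simp⟩) ∅ (fun v hv => hv.elim)
      fun u => Or.inl (evec_mem_nilpotentVectors_of_root hpar hconn hlam hS hr u)
  rcases isEmpty_or_nonempty V with hV | hV
  · exact ⟨0, isCyclicVector_of_forall_evec_mem _ _ fun u => (hV.false u).elim⟩
  obtain ⟨v, hinj, hv, hsub⟩ := exists_biinfinite_path hE hroot hleaf hfin
  obtain ⟨a, ha0, ha1, ha⟩ := exists_weight_quotients (L := fun n => lam (v n))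
    (fun n => hlam _ ⟨_, hv n⟩) (fun n => weight_le_one hpar hS hcon (hv n))
    (not_tendsto_prod_weights hS hC1 (fun n => hlam _ ⟨_, hv n⟩) hv hsub)
  obtain ⟨b, hb, hbv⟩ := exists_cyclic_for_bilateral (ContinuousLinearMap.adjoint S)
    (orthonormal_evec.comp v hinj) ha0 ha1 fun n => by
      rw [map_smul, Function.comp_apply, Function.comp_apply,
        adjoint_shift_evec_of_edge hpar hS (hv n), smul_smul, ha, mul_comm]
      push_cast
      rfl
  refine exists_isCyclicVector_of_sub_mem_nilpotentVectors _ hsurj b hb (Set.range v)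
    (by rintro _ ⟨n, rfl⟩; exact hbv n) fun u => Or.inr ?_
  obtain ⟨n, c, h⟩ := exists_evec_sub_mem_nilpotentVectors hpar hconn hlam hS hv u
  exact ⟨v n, ⟨n, rfl⟩, c, h⟩
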